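/- Let a : ℝ → ℝ be a symmetric function, Lipschitz continuous on [−1,1], such that lim_{|x|→0}(1 − a(x))/|x|^q = c̄_q ∈ (0,∞) for a fixed q ∈ {1,2}, and let γ : ℤ → ℝ be symmetric (γ(−k) = γ(k)) with ∑_{k=1}^{∞} k²·|γ(k)| < ∞. Then as l → ∞: (i) l^q·∑_{k=−l}^{l}[a(k/l) − 1]·γ(k) → −c̄_q·∑_{k=−∞}^{∞}|k|^q·γ(k); and (ii) l^q·∑_{|k|>l}γ(k) → 0. Consequently, l^q·(∑_{k=−l}^{l} a(k/l)γ(k) − ∑_{k∈ℤ}γ(k)) → −c̄_q·∑_{k∈ℤ}|k|^q·γ(k). -/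

import Mathlib

open Filter Finset
open scoped Topology

noncomputable section

/-- A function continuous on `[-1, 1]` whose deviation from `1` is asymptotically of order `|x| ^ q`
at the punctured origin takes the value `1` there. -/
lemma eq_one_at_zero_of_tendsto_div {a : ℝ → ℝ} {q : ℕ} {c : ℝ} (hq : q ≠ 0)
    (ha : ContinuousOn a (Set.Icc (-1 : ℝ) 1))
    (hlim : Tendsto (fun x : ℝ => (1 - a x) / |x| ^ q) (𝓝[≠] 0) (𝓝 c)) : a 0 = 1 := by
  have hpow : Tendsto (fun x : ℝ => |x| ^ q) (𝓝[≠] 0) (𝓝 0) := by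
    have h : Continuous fun x : ℝ => |x| ^ q := by fun_prop
    simpa [hq] using (h.tendsto 0).mono_left nhdsWithin_le_nhds
  have hdiff : Tendsto (fun x : ℝ => 1 - a x) (𝓝[≠] 0) (𝓝 0) := by
    have h := hlim.mul hpow
    rw [mul_zero] at h
    refine h.congr' ?_
    filter_upwards [self_mem_nhdsWithin] with x hx
    exact div_mul_cancel₀ _ (pow_ne_zero _ (abs_ne_zero.mpr hx))
  have hcont : ContinuousAt a 0 :=
    ha.continuousAt (Icc_mem_nhds (by norm_num) (by norm_num))
  have h0 : Tendsto (fun x : ℝ => 1 - a x) (𝓝[≠] 0) (𝓝 (1 - a 0)) :=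
    (hcont.tendsto.mono_left nhdsWithin_le_nhds).const_sub 1
  linarith [tendsto_nhds_unique h0 hdiff]

/-- A global bound on `[-1, 1]` deduced from the behaviour at the origin. -/
lemma exists_abs_one_sub_le_mul_pow {a : ℝ → ℝ} {q : ℕ} {c : ℝ}
    (ha : ContinuousOn a (Set.Icc (-1 : ℝ) 1)) (ha0 : a 0 = 1)
    (hlim : Tendsto (fun x : ℝ => (1 - a x) / |x| ^ q) (𝓝[≠] 0) (𝓝 c)) :
    ∃ M : ℝ, 0 ≤ M ∧ ∀ x ∈ Set.Icc (-1 : ℝ) 1, |a x - 1| ≤ M * |x| ^ q := by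
  obtain ⟨B, hB⟩ := isCompact_Icc.exists_bound_of_continuousOn
    (ha.sub (continuousOn_const (c := (1 : ℝ))))
  have hev := hlim.abs.eventually (ge_mem_nhds (lt_add_one |c|))
  obtain ⟨δ, hδ, hnear⟩ := Metric.mem_nhdsWithin_iff.mp hev
  have hB0 : 0 ≤ B := (norm_nonneg _).trans (hB 0 (by norm_num))
  have hδq : 0 < δ ^ q := pow_pos hδ q
  have hquot : 0 ≤ B / δ ^ q := div_nonneg hB0 hδq.le
  refine ⟨|c| + 1 + B / δ ^ q, by positivity, fun x hx => ?_⟩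
  have hpow : 0 ≤ |x| ^ q := by positivity
  rcases eq_or_ne x 0 with rfl | hx0
  · rw [ha0, sub_self, abs_zero]
    positivity
  rcases lt_or_ge |x| δ with hlt | hge
  · have h : |(1 - a x) / |x| ^ q| ≤ |c| + 1 := hnear ⟨by simpa using hlt, hx0⟩
    have hpos : 0 < |x| ^ q := pow_pos (abs_pos.mpr hx0) q
    rw [abs_div, abs_of_pos hpos, div_le_iff₀ hpos, abs_sub_comm] at h
    nlinarith
  · have h1 : |a x - 1| ≤ B := hB x hx
    have h2 : δ ^ q ≤ |x| ^ q := by gcongr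
    have h3 : B ≤ B / δ ^ q * |x| ^ q := by
      calc B = B / δ ^ q * δ ^ q := (div_mul_cancel₀ _ hδq.ne').symm
        _ ≤ _ := by gcongr
    nlinarith [abs_nonneg c]

/-- Rescaled kernel increments converge along `k / l`. -/
lemma tendsto_pow_mul_kernel_sub_one {a : ℝ → ℝ} {q : ℕ} {c : ℝ} (hq : q ≠ 0) (ha0 : a 0 = 1)
    (hlim : Tendsto (fun x : ℝ => (1 - a x) / |x| ^ q) (𝓝[≠] 0) (𝓝 c)) (k : ℤ) :
    Tendsto (fun l : ℕ => (l : ℝ) ^ q * (a ((k : ℝ) / (l : ℝ)) - 1)) atTop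
      (𝓝 (-(c * |(k : ℝ)| ^ q))) := by
  rcases eq_or_ne k 0 with rfl | hk
  · simp [ha0, hq]
  have hk' : (k : ℝ) ≠ 0 := by exact_mod_cast hk
  have harg : Tendsto (fun l : ℕ => (k : ℝ) / (l : ℝ)) atTop (𝓝[≠] 0) := by
    refine tendsto_nhdsWithin_iff.mpr ⟨tendsto_const_div_atTop_nhds_zero_nat _, ?_⟩
    filter_upwards [eventually_gt_atTop 0] with l hl
    exact div_ne_zero hk' (by positivity)
  refine (((hlim.comp harg).mul_const (|(k : ℝ)| ^ q)).neg).congr' ?_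
  filter_upwards [eventually_gt_atTop 0] with l hl
  have hl' : (0 : ℝ) < l := by exact_mod_cast hl
  have hkq : |(k : ℝ)| ^ q ≠ 0 := pow_ne_zero _ (abs_ne_zero.mpr hk')
  simp only [Function.comp_apply, abs_div, abs_of_pos hl', div_pow]
  field_simp
  ring

/-- A symmetric sequence with a summable one-sided moment has a summable two-sided moment. -/
lemma summable_int_abs_pow_mul_abs {γ : ℤ → ℝ} {p : ℕ} (hγ_symm : ∀ k, γ (-k) = γ k)
    (hγ : Summable fun k : ℕ => (k : ℝ) ^ p * |γ (k : ℤ)|) :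
    Summable fun k : ℤ => |(k : ℝ)| ^ p * |γ k| := by
  refine Summable.of_nat_of_neg ?_ ?_ <;> simpa [hγ_symm] using hγ

/-- Lower positive moments are summable if a higher moment is. -/
lemma summable_int_abs_pow_mul_abs_of_le {γ : ℤ → ℝ} {p q : ℕ} (hq : q ≠ 0) (hqp : q ≤ p)
    (hγ : Summable fun k : ℤ => |(k : ℝ)| ^ p * |γ k|) :
    Summable fun k : ℤ => |(k : ℝ)| ^ q * |γ k| := by
  refine hγ.of_nonneg_of_le (fun k => by positivity) fun k => ?_
  rcases eq_or_ne k 0 with rfl | hk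
  · simp [hq]; positivity
  · have h1 : (1 : ℝ) ≤ |(k : ℝ)| := by exact_mod_cast Int.one_le_abs hk
    gcongr

/-- A sequence with a summable absolute moment is summable. -/
lemma summable_of_summable_int_abs_pow_mul_abs {γ : ℤ → ℝ} {p : ℕ}
    (hγ : Summable fun k : ℤ => |(k : ℝ)| ^ p * |γ k|) : Summable γ := by
  refine Summable.of_norm_bounded_eventually hγ ?_
  filter_upwards [(Set.finite_singleton (0 : ℤ)).compl_mem_cofinite] with k hk
  have h1 : (1 : ℝ) ≤ |(k : ℝ)| := by exact_mod_cast Int.one_le_abs hk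
  rw [Real.norm_eq_abs]
  exact le_mul_of_one_le_left (abs_nonneg _) (one_le_pow₀ h1)

/-- A sum over a symmetric integer interval as a truncated series. -/
lemma sum_Icc_neg_eq_tsum_ite (f : ℤ → ℝ) (l : ℕ) :
    ∑ k ∈ Finset.Icc (-(l : ℤ)) (l : ℤ), f k = ∑' k : ℤ, if |k| ≤ (l : ℤ) then f k else 0 := by
  rw [tsum_eq_sum (s := Finset.Icc (-(l : ℤ)) (l : ℤ))]
  · refine Finset.sum_congr rfl fun k hk => (if_pos ?_).symm
    exact abs_le.mpr (Finset.mem_Icc.mp hk)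
  · intro k hk
    exact if_neg fun h => hk (Finset.mem_Icc.mpr (abs_le.mp h))

/-- The series splits into its symmetric partial sum and its tail. -/
lemma sum_Icc_neg_add_tsum_tail {γ : ℤ → ℝ} (hγ : Summable γ) (l : ℕ) :
    ∑ k ∈ Finset.Icc (-(l : ℤ)) (l : ℤ), γ k + (∑' k : ℤ, if (l : ℤ) < |k| then γ k else 0)
      = ∑' k : ℤ, γ k := by
  have h1 : Summable fun k : ℤ => if |k| ≤ (l : ℤ) then γ k else 0 :=
    (hγ.indicator {k : ℤ | |k| ≤ (l : ℤ)}).congr fun k => by simp [Set.indicator_apply]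
  have h2 : Summable fun k : ℤ => if (l : ℤ) < |k| then γ k else 0 :=
    (hγ.indicator {k : ℤ | (l : ℤ) < |k|}).congr fun k => by simp [Set.indicator_apply]
  rw [sum_Icc_neg_eq_tsum_ite, ← h1.tsum_add h2]
  refine tsum_congr fun k => ?_
  rcases le_or_gt |k| (l : ℤ) with h | h
  · simp [h, h.not_gt]
  · simp [h, h.not_ge]

/-- The tail of a series with summable `q`-th absolute moment is `o(l ^ (-q))`. -/
lemma tendsto_pow_mul_tsum_tail {γ : ℤ → ℝ} {q : ℕ}
    (hγ : Summable fun k : ℤ => |(k : ℝ)| ^ q * |γ k|) :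
    Tendsto (fun l : ℕ => (l : ℝ) ^ q * ∑' k : ℤ, if (l : ℤ) < |k| then γ k else 0)
      atTop (𝓝 0) := by
  have key := tendsto_tsum_of_dominated_convergence (𝓕 := atTop)
    (f := fun (l : ℕ) (k : ℤ) => (l : ℝ) ^ q * if (l : ℤ) < |k| then γ k else 0)
    (g := fun _ => 0) hγ (fun k => ?_) (Eventually.of_forall fun l k => ?_)
  · simpa only [tsum_mul_left, tsum_zero] using key
  · refine tendsto_const_nhds.congr' ?_
    filter_upwards [eventually_ge_atTop k.natAbs] with l hl
    rw [if_neg (by have := Int.abs_eq_natAbs k; omega), mul_zero]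
  · split_ifs with h
    · have hlk : (l : ℝ) ≤ |(k : ℝ)| := by exact_mod_cast h.le
      rw [norm_mul, norm_pow, Real.norm_natCast, Real.norm_eq_abs]
      gcongr
    · rw [mul_zero, norm_zero]
      positivity

/-- The rescaled weighted kernel bias converges, by dominated convergence. -/
lemma tendsto_pow_mul_sum_kernel_sub_one {a : ℝ → ℝ} {γ : ℤ → ℝ} {q : ℕ} {c : ℝ} (hq : q ≠ 0)
    (ha : ContinuousOn a (Set.Icc (-1 : ℝ) 1))
    (hlim : Tendsto (fun x : ℝ => (1 - a x) / |x| ^ q) (𝓝[≠] 0) (𝓝 c))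
    (hγ : Summable fun k : ℤ => |(k : ℝ)| ^ q * |γ k|) :
    Tendsto (fun l : ℕ => (l : ℝ) ^ q *
        ∑ k ∈ Finset.Icc (-(l : ℤ)) (l : ℤ), (a ((k : ℝ) / (l : ℝ)) - 1) * γ k)
      atTop (𝓝 (-(c * ∑' k : ℤ, |(k : ℝ)| ^ q * γ k))) := by
  have ha0 := eq_one_at_zero_of_tendsto_div hq ha hlim
  obtain ⟨M, hM, hbound⟩ := exists_abs_one_sub_le_mul_pow ha ha0 hlim
  have key := tendsto_tsum_of_dominated_convergence (𝓕 := atTop)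
    (f := fun (l : ℕ) (k : ℤ) =>
      (l : ℝ) ^ q * if |k| ≤ (l : ℤ) then (a ((k : ℝ) / (l : ℝ)) - 1) * γ k else 0)
    (g := fun k : ℤ => -c * (|(k : ℝ)| ^ q * γ k)) (hγ.mul_left M) (fun k => ?_)
    ((eventually_gt_atTop 0).mono fun l hl k => ?_)
  · rw [tsum_mul_left, neg_mul] at key
    simpa only [tsum_mul_left, ← sum_Icc_neg_eq_tsum_ite] using key
  · have h := (tendsto_pow_mul_kernel_sub_one hq ha0 hlim k).mul_const (γ k)
    rw [show -c * (|(k : ℝ)| ^ q * γ k) = -(c * |(k : ℝ)| ^ q) * γ k by ring]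
    refine h.congr' ?_
    filter_upwards [eventually_ge_atTop k.natAbs] with l hl
    rw [if_pos (by have := Int.abs_eq_natAbs k; omega), mul_assoc]
  · split_ifs with h
    · have hl' : (0 : ℝ) < l := by exact_mod_cast hl
      have hkl : |(k : ℝ)| ≤ l := by exact_mod_cast h
      have hmem : (k : ℝ) / l ∈ Set.Icc (-1 : ℝ) 1 := by
        rw [Set.mem_Icc, ← abs_le, abs_div, abs_of_pos hl']
        exact div_le_one_of_le₀ hkl hl'.le
      have hb := hbound _ hmem
      rw [abs_div, abs_of_pos hl', div_pow] at hb
      rw [norm_mul, norm_mul, norm_pow, Real.norm_natCast, Real.norm_eq_abs, Real.norm_eq_abs]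
      calc (l : ℝ) ^ q * (|a ((k : ℝ) / l) - 1| * |γ k|)
          ≤ (l : ℝ) ^ q * (M * (|(k : ℝ)| ^ q / (l : ℝ) ^ q) * |γ k|) := by gcongr
        _ = M * (|(k : ℝ)| ^ q * |γ k|) := by field_simp
    · rw [mul_zero, norm_zero]
      positivity

/-- **Deterministic HAC bias computation** (from the proof of Proposition 1).
Let `a` be a symmetric kernel, Lipschitz on `[-1,1]`, with
`(1 - a(x))/|x|^q → c̄_q ∈ (0,∞)` as `x → 0`, for a fixed `q ∈ {1,2}`, and let
`γ : ℤ → ℝ` be symmetric with `∑ k² |γ(k)| < ∞`.  Then as `l → ∞`: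
(i) `l^q ∑_{k=-l}^{l} (a(k/l) - 1) γ(k) → -c̄_q ∑_{k∈ℤ} |k|^q γ(k)`;
(ii) `l^q ∑_{|k|>l} γ(k) → 0`;  and consequently
(iii) `l^q (∑_{k=-l}^{l} a(k/l) γ(k) - ∑_{k∈ℤ} γ(k)) → -c̄_q ∑_{k∈ℤ} |k|^q γ(k)`. -/
theorem hac_kernel_bias
    (a : ℝ → ℝ) (q : ℕ) (hq : q = 1 ∨ q = 2)
    (ha_symm : ∀ x, a (-x) = a x)
    (ha_lip : ∃ C : NNReal, LipschitzOnWith C a (Set.Icc (-1 : ℝ) 1))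
    (cbar : ℝ) (hcbar_pos : 0 < cbar)
    (ha_lim : Tendsto (fun x : ℝ => (1 - a x) / |x| ^ q) (𝓝[≠] 0) (𝓝 cbar))
    (γ : ℤ → ℝ) (hγ_symm : ∀ k, γ (-k) = γ k)
    (hγ_sum : Summable fun k : ℕ => (k : ℝ) ^ 2 * |γ (k : ℤ)|) :
    Tendsto (fun l : ℕ => (l : ℝ) ^ q *
        ∑ k ∈ Finset.Icc (-(l : ℤ)) (l : ℤ), (a ((k : ℝ) / (l : ℝ)) - 1) * γ k)
      atTop (𝓝 (-(cbar * ∑' k : ℤ, |(k : ℝ)| ^ q * γ k)))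
    ∧ Tendsto (fun l : ℕ => (l : ℝ) ^ q *
        ∑' k : ℤ, if (l : ℤ) < |k| then γ k else 0) atTop (𝓝 0)
    ∧ Tendsto (fun l : ℕ => (l : ℝ) ^ q *
        ((∑ k ∈ Finset.Icc (-(l : ℤ)) (l : ℤ), a ((k : ℝ) / (l : ℝ)) * γ k) - ∑' k : ℤ, γ k))
      atTop (𝓝 (-(cbar * ∑' k : ℤ, |(k : ℝ)| ^ q * γ k))) := by
  obtain ⟨C, hC⟩ := ha_lip
  have hq0 : q ≠ 0 := by omega
  have hmom := summable_int_abs_pow_mul_abs hγ_symm hγ_sum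
  have hγq := summable_int_abs_pow_mul_abs_of_le hq0 (by omega) hmom
  have hγ1 := summable_of_summable_int_abs_pow_mul_abs hmom
  have hmain := tendsto_pow_mul_sum_kernel_sub_one hq0 hC.continuousOn ha_lim hγq
  have htail := tendsto_pow_mul_tsum_tail hγq
  refine ⟨hmain, htail, ?_⟩
  have hsub := hmain.sub htail
  rw [sub_zero] at hsub
  refine hsub.congr fun l => ?_
  simp only [← sum_Icc_neg_add_tsum_tail hγ1 l, sub_mul, one_mul, Finset.sum_sub_distrib]
  ring

end
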